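/- Let (X,d) be a compact metric space, f : X → X continuous, and ψ ∈ C(X,ℝ) with ψ > 0. If φ₁, φ₂ ∈ C(X,ℝ) are cohomologous, i.e. φ₁ = φ₂ + h − h∘f for some h ∈ C(X,ℝ), then P_ψ(φ₁) = P_ψ(φ₂). In particular, if φ is cohomologous to ψ, then for every t ∈ ℝ one has P_ψ(tφ) = t + P_ψ(0). -/

import Mathlib

open Filter Set Topology MeasureTheory ENNReal

variable {X : Type*}

/-- Birkhoff sum `S_n φ = ∑_{i<n} φ ∘ f^i`. -/
def birkhoff (f : X → X) (φ : X → ℝ) (n : ℕ) (x : X) : ℝ :=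
  ∑ i ∈ Finset.range n, φ (f^[i] x)

section Metric
variable [MetricSpace X]

/-- `F` is an `(n,ε)`-spanning set of `Z`: every `y ∈ Z` is within Bowen distance
`d_n ≤ ε` of some point of `F`. -/
def IsSpanningSetOf (f : X → X) (n : ℕ) (ε : ℝ) (Z : Set X) (F : Finset X) : Prop :=
  ∀ y ∈ Z, ∃ x ∈ F, ∀ i < n, dist (f^[i] x) (f^[i] y) ≤ ε

/-- `E` is an `(n,ε)`-separated set of `Z`: `E ⊆ Z` and distinct points of `E` are at
Bowen distance `d_n > ε`. -/
def IsSeparatedSetOf (f : X → X) (n : ℕ) (ε : ℝ) (Z : Set X) (E : Finset X) : Prop :=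
  (E : Set X) ⊆ Z ∧ ∀ x ∈ E, ∀ y ∈ E, x ≠ y → ∃ i < n, ε < dist (f^[i] x) (f^[i] y)

/-- `S_T = {n : ℕ | ∃ x, S_nψ(x) ≤ T < S_{n+1}ψ(x)}`. -/
def inducedST (f : X → X) (ψ : X → ℝ) (T : ℝ) : Set ℕ :=
  {n | ∃ x : X, birkhoff f ψ n x ≤ T ∧ T < birkhoff f ψ (n + 1) x}

/-- `X_n = {x | S_nψ(x) ≤ T < S_{n+1}ψ(x)}`. -/
def inducedXn (f : X → X) (ψ : X → ℝ) (T : ℝ) (n : ℕ) : Set X :=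
  {x | birkhoff f ψ n x ≤ T ∧ T < birkhoff f ψ (n + 1) x}

/-- `Q_{ψ,T}(f,φ,ε)`: infimum over families of `(n,ε)`-spanning sets of the `X_n`, `n ∈ S_T`,
of `∑_{n ∈ S_T} ∑_{x ∈ F_n} e^{S_nφ(x)}`. -/
noncomputable def inducedQ (f : X → X) (ψ φ : X → ℝ) (T ε : ℝ) : ℝ≥0∞ :=
  ⨅ (F : ℕ → Finset X) (_ : ∀ n ∈ inducedST f ψ T,
      IsSpanningSetOf f n ε (inducedXn f ψ T n) (F n)),
    ∑' n : inducedST f ψ T, ∑ x ∈ F n, ENNReal.ofReal (Real.exp (birkhoff f φ n x))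

/-- `P_{ψ,T}(f,φ,ε)`: supremum over families of `(n,ε)`-separated sets of the `X_n`, `n ∈ S_T`,
of `∑_{n ∈ S_T} ∑_{x ∈ E_n} e^{S_nφ(x)}`. -/
noncomputable def inducedPsep (f : X → X) (ψ φ : X → ℝ) (T ε : ℝ) : ℝ≥0∞ :=
  ⨆ (E : ℕ → Finset X) (_ : ∀ n ∈ inducedST f ψ T,
      IsSeparatedSetOf f n ε (inducedXn f ψ T n) (E n)),
    ∑' n : inducedST f ψ T, ∑ x ∈ E n, ENNReal.ofReal (Real.exp (birkhoff f φ n x))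

/-- The ψ-induced topological pressure
`P_ψ(φ) = lim_{ε→0⁺} limsup_{T→∞} (1/T) log Q_{ψ,T}(f,φ,ε)`, the limit as `ε → 0⁺`
being realized as a `limsup` along `𝓝[>] 0` (since `ε ↦ limsup_T …` is monotone,
this coincides with the limit). -/
noncomputable def inducedPressure (f : X → X) (ψ φ : X → ℝ) : EReal :=
  limsup (fun ε : ℝ =>
    limsup (fun T : ℝ => ENNReal.log (inducedQ f ψ φ T ε) * ((T⁻¹ : ℝ) : EReal)) atTop)
    (𝓝[>] (0 : ℝ))

/-- Topological entropy `h_top(f) = P_ψ(0)` with `ψ ≡ 1`. -/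
noncomputable def topEntropy (f : X → X) : EReal :=
  inducedPressure f (fun _ => 1) (fun _ => 0)

end Metric

section InducedPressure
variable [MetricSpace X]

/-- Points of a spanning set that are not Bowen-close to the spanned set can be discarded, so
`inducedQ` only sees Birkhoff sums at points close to `X_n`. -/
lemma inducedQ_le_mul {f : X → X} {ψ φ₁ φ₂ : X → ℝ} {T ε c : ℝ}
    (H : ∀ n x y, y ∈ inducedXn f ψ T n → (∀ i < n, dist (f^[i] x) (f^[i] y) ≤ ε) →
      birkhoff f φ₁ n x ≤ c + birkhoff f φ₂ n x) :
    inducedQ f ψ φ₁ T ε ≤ ENNReal.ofReal (Real.exp c) * inducedQ f ψ φ₂ T ε := by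
  classical
  have hc : ENNReal.ofReal (Real.exp c) ≠ 0 := by simp [Real.exp_pos]
  unfold inducedQ
  rw [ENNReal.mul_iInf_of_ne hc ENNReal.ofReal_ne_top]
  refine le_iInf fun F => ?_
  rw [ENNReal.mul_iInf_of_ne hc ENNReal.ofReal_ne_top]
  refine le_iInf fun hF => ?_
  let close (n : ℕ) (x : X) : Prop :=
    ∃ y ∈ inducedXn f ψ T n, ∀ i < n, dist (f^[i] x) (f^[i] y) ≤ ε
  have hG : ∀ n ∈ inducedST f ψ T,
      IsSpanningSetOf f n ε (inducedXn f ψ T n) ((F n).filter (close n)) := by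
    intro n hn y hy
    obtain ⟨x, hx, hxy⟩ := hF n hn y hy
    exact ⟨x, Finset.mem_filter.2 ⟨hx, y, hy, hxy⟩, hxy⟩
  refine (iInf₂_le (fun n => (F n).filter (close n)) hG).trans ?_
  rw [← ENNReal.tsum_mul_left]
  refine ENNReal.tsum_le_tsum fun n => ?_
  rw [Finset.mul_sum]
  refine (Finset.sum_le_sum fun x hx => ?_).trans
    (Finset.sum_le_sum_of_subset (Finset.filter_subset (close n) (F n)))
  obtain ⟨-, y, hy, hxy⟩ := Finset.mem_filter.1 hx
  rw [← ENNReal.ofReal_mul (Real.exp_pos _).le, ← Real.exp_add]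
  exact ENNReal.ofReal_le_ofReal (Real.exp_le_exp.2 (H n x y hy hxy))

lemma EReal.limsup_coe_add {ι : Type*} {l : Filter ι} [l.NeBot] (c : ℝ) (u : ι → EReal) :
    limsup (fun i => (c : EReal) + u i) l = (c : EReal) + limsup u l := by
  have hcont : Continuous fun x : EReal => (c : EReal) + x :=
    continuous_iff_continuousAt.2 fun x =>
      (EReal.continuousAt_add (p := ((c : EReal), x)) (.inl (EReal.coe_ne_top c))
        (.inl (EReal.coe_ne_bot c))).comp (by fun_prop)
  have hmono : Monotone fun x : EReal => (c : EReal) + x := fun _ _ h => add_le_add le_rfl h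
  exact (hmono.map_limsup_of_continuousAt u hcont.continuousAt).symm

lemma inducedPressure_le_coe_add {f : X → X} {ψ φ₁ φ₂ : X → ℝ} {c : ℝ}
    (H : ∀ᶠ ε in 𝓝[>] (0 : ℝ), ∀ᶠ T in atTop, ∀ n x y, y ∈ inducedXn f ψ T n →
      (∀ i < n, dist (f^[i] x) (f^[i] y) ≤ ε) →
        birkhoff f φ₁ n x ≤ c * T + birkhoff f φ₂ n x) :
    inducedPressure f ψ φ₁ ≤ (c : EReal) + inducedPressure f ψ φ₂ := by
  unfold inducedPressure
  rw [← EReal.limsup_coe_add]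
  refine limsup_le_limsup (H.mono fun ε hε => ?_)
  simp only []
  rw [← EReal.limsup_coe_add]
  refine limsup_le_limsup ?_
  filter_upwards [hε, eventually_gt_atTop 0] with T hT hT0
  have hinv : (0 : EReal) ≤ ((T⁻¹ : ℝ) : EReal) := by exact_mod_cast (inv_pos.2 hT0).le
  calc ENNReal.log (inducedQ f ψ φ₁ T ε) * ((T⁻¹ : ℝ) : EReal)
      ≤ (((c * T : ℝ) : EReal) + ENNReal.log (inducedQ f ψ φ₂ T ε)) * ((T⁻¹ : ℝ) : EReal) := by
        refine mul_le_mul_of_nonneg_right ?_ hinv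
        rw [← Real.log_exp (c * T), ← ENNReal.log_ofReal_of_pos (Real.exp_pos _),
          ← ENNReal.log_mul_add]
        exact ENNReal.log_le_log (inducedQ_le_mul hT)
    _ = (c : EReal) + ENNReal.log (inducedQ f ψ φ₂ T ε) * ((T⁻¹ : ℝ) : EReal) := by
        rw [EReal.right_distrib_of_nonneg_of_ne_top hinv (EReal.coe_ne_top _), ← EReal.coe_mul,
          mul_inv_cancel_right₀ hT0.ne']

lemma inducedPressure_le_coe_add_of_forall_pos {f : X → X} {ψ φ₁ φ₂ : X → ℝ} {c : ℝ}
    (H : ∀ δ > 0, ∀ᶠ ε in 𝓝[>] (0 : ℝ), ∀ᶠ T in atTop, ∀ n x y, y ∈ inducedXn f ψ T n →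
      (∀ i < n, dist (f^[i] x) (f^[i] y) ≤ ε) →
        birkhoff f φ₁ n x ≤ (c + δ) * T + birkhoff f φ₂ n x) :
    inducedPressure f ψ φ₁ ≤ (c : EReal) + inducedPressure f ψ φ₂ := by
  have key : ∀ δ > 0, inducedPressure f ψ φ₁ ≤ ((c + δ : ℝ) : EReal) + inducedPressure f ψ φ₂ :=
    fun δ hδ => inducedPressure_le_coe_add (H δ hδ)
  generalize inducedPressure f ψ φ₁ = a at key ⊢
  generalize inducedPressure f ψ φ₂ = b at key ⊢
  induction b with
  | bot => simpa using key 1 one_pos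
  | top => simp
  | coe b =>
    refine EReal.le_of_forall_lt_iff_le.1 fun z hz => ?_
    have hz' : c + b < z := by exact_mod_cast hz
    refine (key (z - (c + b)) (sub_pos.2 hz')).trans (le_of_eq ?_)
    rw [← EReal.coe_add]
    congr 1
    ring

end InducedPressure

lemma birkhoff_eq_add_sub_of_cohomologous {f : X → X} {φ₁ φ₂ h : X → ℝ}
    (H : ∀ x, φ₁ x = φ₂ x + h x - h (f x)) (n : ℕ) (x : X) :
    birkhoff f φ₁ n x = birkhoff f φ₂ n x + h x - h (f^[n] x) := by
  induction n with
  | zero => simp [birkhoff]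
  | succ n ih =>
    simp only [birkhoff, Finset.sum_range_succ, Function.iterate_succ_apply', H] at ih ⊢
    linarith

lemma exists_forall_abs_le_of_continuous [TopologicalSpace X] [CompactSpace X] {g : X → ℝ}
    (hg : Continuous g) : ∃ M : ℝ, ∀ x, |g x| ≤ M := by
  obtain ⟨M, hM⟩ := isCompact_univ.exists_bound_of_continuousOn hg.continuousOn
  exact ⟨M, fun x => hM x (mem_univ x)⟩

lemma exists_pos_forall_le_of_continuous [TopologicalSpace X] [CompactSpace X] {g : X → ℝ}
    (hg : Continuous g) (hpos : ∀ x, 0 < g x) : ∃ m > 0, ∀ x, m ≤ g x := by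
  cases isEmpty_or_nonempty X
  · exact ⟨1, one_pos, fun x => isEmptyElim x⟩
  · obtain ⟨x, -, hx⟩ := isCompact_univ.exists_isMinOn univ_nonempty hg.continuousOn
    exact ⟨g x, hpos x, fun y => hx (mem_univ y)⟩

/-- Near `X_n`, the Birkhoff sum of `ψ` is `T` up to an error that is small relative to `T`. -/
lemma eventually_abs_birkhoff_sub_le [MetricSpace X] [CompactSpace X] {f : X → X} {ψ : X → ℝ}
    (hψ : Continuous ψ) (hψpos : ∀ x, 0 < ψ x) {δ : ℝ} (hδ : 0 < δ) :
    ∀ᶠ ε in 𝓝[>] (0 : ℝ), ∀ᶠ T in atTop, ∀ n x y, y ∈ inducedXn f ψ T n →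
      (∀ i < n, dist (f^[i] x) (f^[i] y) ≤ ε) → |birkhoff f ψ n x - T| ≤ δ * T := by
  obtain ⟨m, hm, hmψ⟩ := exists_pos_forall_le_of_continuous hψ hψpos
  obtain ⟨M, hM⟩ := exists_forall_abs_le_of_continuous hψ
  obtain ⟨r, hr, hrψ⟩ := Metric.uniformContinuous_iff.1
    (CompactSpace.uniformContinuous_of_continuous hψ) (δ / 2 * m) (by positivity)
  filter_upwards [nhdsWithin_le_nhds (gt_mem_nhds hr)] with ε hε
  filter_upwards [eventually_ge_atTop (2 * M / δ)] with T hT n x y hy hxy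
  have hMT : M ≤ δ / 2 * T := by
    rw [div_le_iff₀ hδ] at hT
    linarith
  have hn : n * m ≤ T := by
    refine le_trans ?_ hy.1
    simpa [birkhoff] using
      Finset.card_nsmul_le_sum (Finset.range n) (fun i => ψ (f^[i] y)) m fun i _ => hmψ _
  have hyT : |birkhoff f ψ n y - T| ≤ M := by
    have hlast := hy.2
    rw [birkhoff, Finset.sum_range_succ, ← birkhoff] at hlast
    have := (abs_le.1 (hM (f^[n] y))).2
    rw [abs_le]
    constructor <;> linarith [hy.1, (abs_nonneg _).trans (hM y)]
  have hdiff : |birkhoff f ψ n x - birkhoff f ψ n y| ≤ n * (δ / 2 * m) := by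
    rw [birkhoff, birkhoff, ← Finset.sum_sub_distrib]
    refine (Finset.abs_sum_le_sum_abs _ _).trans ?_
    simpa using Finset.sum_le_card_nsmul (Finset.range n)
      (fun i => |ψ (f^[i] x) - ψ (f^[i] y)|) (δ / 2 * m) fun i hi =>
        (hrψ ((hxy i (Finset.mem_range.1 hi)).trans_lt hε)).le
  calc |birkhoff f ψ n x - T|
      ≤ |birkhoff f ψ n x - birkhoff f ψ n y| + |birkhoff f ψ n y - T| := abs_sub_le _ _ _
    _ ≤ n * (δ / 2 * m) + M := add_le_add hdiff hyT
    _ = δ / 2 * (n * m) + M := by ring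
    _ ≤ δ / 2 * T + δ / 2 * T := by gcongr
    _ = δ * T := by ring

lemma inducedPressure_le_of_cohomologous [MetricSpace X] [CompactSpace X] {f : X → X}
    {ψ φ₁ φ₂ h : X → ℝ} (hh : Continuous h) (H : ∀ x, φ₁ x = φ₂ x + h x - h (f x)) :
    inducedPressure f ψ φ₁ ≤ inducedPressure f ψ φ₂ := by
  obtain ⟨M, hM⟩ := exists_forall_abs_le_of_continuous hh
  rw [← zero_add (inducedPressure f ψ φ₂), ← EReal.coe_zero]
  refine inducedPressure_le_coe_add_of_forall_pos fun δ hδ => Eventually.of_forall fun ε => ?_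
  filter_upwards [eventually_ge_atTop (2 * M / δ)] with T hT n x y _ _
  rw [div_le_iff₀ hδ] at hT
  rw [birkhoff_eq_add_sub_of_cohomologous H]
  linarith [(abs_le.1 (hM x)).2, (abs_le.1 (hM (f^[n] x))).1]

lemma inducedPressure_eq_of_cohomologous [MetricSpace X] [CompactSpace X] {f : X → X}
    {ψ φ₁ φ₂ h : X → ℝ} (hh : Continuous h) (H : ∀ x, φ₁ x = φ₂ x + h x - h (f x)) :
    inducedPressure f ψ φ₁ = inducedPressure f ψ φ₂ :=
  (inducedPressure_le_of_cohomologous hh H).antisymm <|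
    inducedPressure_le_of_cohomologous (h := fun x => -h x) hh.neg fun x => by
      rw [H]
      ring

lemma inducedPressure_const_mul [MetricSpace X] [CompactSpace X] {f : X → X} {ψ : X → ℝ}
    (hψ : Continuous ψ) (hψpos : ∀ x, 0 < ψ x) (t : ℝ) :
    inducedPressure f ψ (fun x => t * ψ x) =
      (t : EReal) + inducedPressure f ψ (fun _ => 0) := by
  have hmul : ∀ n x, birkhoff f (fun x => t * ψ x) n x = t * birkhoff f ψ n x :=
    fun n x => (Finset.mul_sum _ _ _).symm
  have hzero : ∀ n x, birkhoff f (fun _ => 0) n x = 0 := fun n x => Finset.sum_const_zero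
  have key : ∀ δ > 0, ∀ᶠ ε in 𝓝[>] (0 : ℝ), ∀ᶠ T in atTop, ∀ n x y, y ∈ inducedXn f ψ T n →
      (∀ i < n, dist (f^[i] x) (f^[i] y) ≤ ε) → |t * birkhoff f ψ n x - t * T| ≤ δ * T := by
    intro δ hδ
    filter_upwards [eventually_abs_birkhoff_sub_le (f := f) hψ hψpos
      (div_pos hδ (by positivity : 0 < |t| + 1))] with ε hε
    filter_upwards [hε, eventually_ge_atTop 0] with T hT hT0 n x y hy hxy
    rw [← mul_sub, abs_mul]
    calc |t| * |birkhoff f ψ n x - T|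
        ≤ (|t| + 1) * (δ / (|t| + 1) * T) := by
          gcongr
          · linarith
          · exact hT n x y hy hxy
      _ = δ * T := by field_simp
  refine le_antisymm (inducedPressure_le_coe_add_of_forall_pos fun δ hδ => ?_) ?_
  · filter_upwards [key δ hδ] with ε hε
    filter_upwards [hε] with T hT n x y hy hxy
    rw [hmul, hzero]
    linarith [(abs_le.1 (hT n x y hy hxy)).2]
  · have hle : inducedPressure f ψ (fun _ => 0) ≤
        ((-t : ℝ) : EReal) + inducedPressure f ψ (fun x => t * ψ x) := by
      refine inducedPressure_le_coe_add_of_forall_pos fun δ hδ => ?_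
      filter_upwards [key δ hδ] with ε hε
      filter_upwards [hε] with T hT n x y hy hxy
      rw [hmul, hzero]
      linarith [(abs_le.1 (hT n x y hy hxy)).1]
    calc (t : EReal) + inducedPressure f ψ (fun _ => 0)
        ≤ (t : EReal) + (((-t : ℝ) : EReal) + inducedPressure f ψ (fun x => t * ψ x)) := by
          gcongr
      _ = inducedPressure f ψ (fun x => t * ψ x) := by
          rw [← add_assoc, ← EReal.coe_add, add_neg_cancel, EReal.coe_zero, zero_add]

/-- If `φ₁` and `φ₂` are cohomologous (`φ₁ = φ₂ + h - h∘f` for some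
continuous `h`), then `P_ψ(φ₁) = P_ψ(φ₂)`; in particular, if `φ` is cohomologous to `ψ`
then `P_ψ(tφ) = t + P_ψ(0)` for every `t ∈ ℝ`. -/
theorem inducedPressure_cohomologous
    {X : Type*} [MetricSpace X] [CompactSpace X]
    (f : X → X) (hf : Continuous f)
    (ψ : X → ℝ) (hψ : Continuous ψ) (hψpos : ∀ x, 0 < ψ x) :
    (∀ φ₁ φ₂ h : X → ℝ, Continuous φ₁ → Continuous φ₂ → Continuous h →
        (∀ x, φ₁ x = φ₂ x + h x - h (f x)) →
        inducedPressure f ψ φ₁ = inducedPressure f ψ φ₂) ∧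
    ∀ φ h : X → ℝ, Continuous φ → Continuous h →
      (∀ x, φ x = ψ x + h x - h (f x)) →
      ∀ t : ℝ, inducedPressure f ψ (fun x => t * φ x) =
        ((t : ℝ) : EReal) + inducedPressure f ψ (fun _ => 0) := by
  refine ⟨fun φ₁ φ₂ h _ _ hh H => inducedPressure_eq_of_cohomologous hh H,
    fun φ h _ hh H t => ?_⟩
  rw [← inducedPressure_const_mul hψ hψpos t]
  exact inducedPressure_eq_of_cohomologous (h := fun x => t * h x) (hh.const_mul t) fun x => by
    rw [H]
    ring
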